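/- arXiv:2003.05141 — 3 statements merged into one kernel-verified Lean document; each statement's English description precedes it below -/
import Mathlib

section
/- Let H = ([n], E) be a simple graph, let 0 < m < |E|, and let P_H^m := conv{d(F) : F ⊆ E, |F| = m} ⊂ ℝ^n. For every edge (one-dimensional face) C = [d(F_1), d(F_2)] of P_H^m, where F_1, F_2 ⊆ E with |F_1| = |F_2| = m and d(F_1) ≠ d(F_2), there exist distinct edges e, f ∈ E such that d(F_2) − d(F_1) is a nonzero scalar multiple of d(e) − d(f). In particular, the set of vectors ±(d(e) − d(f)) over pairs of distinct edges e, f ∈ E contains a direction of every edge of P_H^m. -/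
/-- The degree sequence of the edge subset `F`, as a real vector. -/
def degSeqR (n : ℕ) (F : Finset (Sym2 (Fin n))) : Fin n → ℝ :=
  fun i => ((F.filter (fun e => i ∈ e)).card : ℝ)

/-- The degree vector of a single edge `e`: `d(e) = 1_i + 1_j` for `e = {i,j}`,
as a real vector. -/
def edgeVecR (n : ℕ) (e : Sym2 (Fin n)) : Fin n → ℝ :=
  fun i => if i ∈ e then 1 else 0

theorem degSeqR_eq_sum_edgeVecR (n : ℕ) (F : Finset (Sym2 (Fin n))) :
    degSeqR n F = ∑ e ∈ F, edgeVecR n e := by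
  ext i
  simp [degSeqR, edgeVecR]

theorem edgeVecR_injective (n : ℕ) : Function.Injective (edgeVecR n) := by
  intro e f h
  refine Sym2.ext fun i => ?_
  have hi := congrFun h i
  by_cases he : i ∈ e <;> by_cases hf : i ∈ f <;> simp_all [edgeVecR]

theorem degSeqR_insert_erase {n : ℕ} {F : Finset (Sym2 (Fin n))} {e f : Sym2 (Fin n)}
    (he : e ∉ F) (hf : f ∈ F) :
    degSeqR n (insert e (F.erase f)) = degSeqR n F + (edgeVecR n e - edgeVecR n f) := by
  simp only [degSeqR_eq_sum_edgeVecR]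
  rw [Finset.sum_insert (fun h => he (Finset.mem_of_mem_erase h)),
    ← Finset.add_sum_erase F _ hf]
  abel

theorem degSeqR_insert_erase_mem_convexHull {n m : ℕ} {E F : Finset (Sym2 (Fin n))}
    {e f : Sym2 (Fin n)} (hF : F ⊆ E) (hc : F.card = m) (heE : e ∈ E) (he : e ∉ F)
    (hf : f ∈ F) :
    degSeqR n (insert e (F.erase f)) ∈
      convexHull ℝ {x : Fin n → ℝ | ∃ F ⊆ E, F.card = m ∧ x = degSeqR n F} := by
  refine subset_convexHull ℝ _ ⟨_, ?_, ?_, rfl⟩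
  · exact Finset.insert_subset heE ((Finset.erase_subset _ _).trans hF)
  · rw [Finset.card_insert_of_notMem (fun h => he (Finset.mem_of_mem_erase h)),
      Finset.card_erase_add_one hf, hc]

/-- every edge (one-dimensional face) `C = [d(F₁), d(F₂)]` of the
polytope `P_H^m = conv{d(F) : F ⊆ E, |F| = m}` has a direction of the form
`d(e) - d(f)` for some pair of distinct edges `e, f ∈ E`; i.e. `d(F₂) - d(F₁)`
is a nonzero scalar multiple of `d(e) - d(f)`. -/
theorem edge_directions_prescribed (n m : ℕ) (E : Finset (Sym2 (Fin n)))
    (hE : ∀ e ∈ E, ¬ e.IsDiag) (hm : 0 < m) (hmE : m < E.card)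
    (F₁ F₂ : Finset (Sym2 (Fin n))) (hF₁ : F₁ ⊆ E) (hF₂ : F₂ ⊆ E)
    (hc₁ : F₁.card = m) (hc₂ : F₂.card = m)
    (hne : degSeqR n F₁ ≠ degSeqR n F₂)
    (hface : IsExtreme ℝ
      (convexHull ℝ {x : Fin n → ℝ | ∃ F ⊆ E, F.card = m ∧ x = degSeqR n F})
      (segment ℝ (degSeqR n F₁) (degSeqR n F₂))) :
    ∃ e ∈ E, ∃ f ∈ E, e ≠ f ∧ ∃ c : ℝ, c ≠ 0 ∧
      degSeqR n F₂ - degSeqR n F₁ = c • (edgeVecR n e - edgeVecR n f) := by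
  have hFne : F₁ ≠ F₂ := fun h => hne (by rw [h])
  obtain ⟨e, he₂, he₁⟩ : ∃ e ∈ F₂, e ∉ F₁ := by
    by_contra! h
    exact hFne (Finset.eq_of_subset_of_card_le h (by omega)).symm
  obtain ⟨f, hf₁, hf₂⟩ : ∃ f ∈ F₁, f ∉ F₂ := by
    by_contra! h
    exact hFne (Finset.eq_of_subset_of_card_le h (by omega))
  have hef : e ≠ f := fun h => he₁ (h ▸ hf₁)
  -- Exchanging `e` and `f` keeps the midpoint, so the exchanged point stays on the face.
  have hmid : (1 / 2 : ℝ) • degSeqR n F₁ + (1 / 2 : ℝ) • degSeqR n F₂ ∈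
      openSegment ℝ (degSeqR n (insert e (F₁.erase f)))
        (degSeqR n (insert f (F₂.erase e))) := by
    refine ⟨1 / 2, 1 / 2, by norm_num, by norm_num, by norm_num, ?_⟩
    rw [degSeqR_insert_erase he₁ hf₁, degSeqR_insert_erase hf₂ he₂]
    module
  have hmem := hface.left_mem_of_mem_openSegment
    (degSeqR_insert_erase_mem_convexHull hF₁ hc₁ (hF₂ he₂) he₁ hf₁)
    (degSeqR_insert_erase_mem_convexHull hF₂ hc₂ (hF₁ hf₁) hf₂ he₂)
    ⟨1 / 2, 1 / 2, by norm_num, by norm_num, by norm_num, rfl⟩ hmid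
  rw [degSeqR_insert_erase he₁ hf₁, segment_eq_image'] at hmem
  obtain ⟨t, -, ht⟩ := hmem
  have hdir : t • (degSeqR n F₂ - degSeqR n F₁) = edgeVecR n e - edgeVecR n f :=
    add_left_cancel ht
  have ht0 : t ≠ 0 := by
    rintro rfl
    rw [zero_smul] at hdir
    exact hef (edgeVecR_injective n (sub_eq_zero.mp hdir.symm))
  exact ⟨e, hF₂ he₂, f, hF₁ hf₁, hef, t⁻¹, inv_ne_zero ht0, by
    rw [← hdir, inv_smul_smul₀ ht0]⟩
end

section
/- Let H = ([n], E) be a simple graph and let P_H := conv{d(F) : F ⊆ E} ⊂ ℝ^n be its degree sequence polytope. For every edge (one-dimensional face) C = [d(F_1), d(F_2)] of P_H with F_1, F_2 ⊆ E and d(F_1) ≠ d(F_2), there exists an edge e ∈ E such that d(F_2) − d(F_1) is a nonzero scalar multiple of d(e). In particular, the set {d(e) : e ∈ E} contains a direction of every edge of P_H. -/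
theorem degSeqR_erase_add {n : ℕ} {F : Finset (Sym2 (Fin n))} {e : Sym2 (Fin n)} (he : e ∈ F) :
    degSeqR n (F.erase e) + edgeVecR n e = degSeqR n F := by
  funext i
  simp only [Pi.add_apply, degSeqR, edgeVecR, Finset.filter_erase]
  split_ifs with hi
  · exact_mod_cast Finset.card_erase_add_one (Finset.mem_filter.2 ⟨he, hi⟩)
  · rw [Finset.erase_eq_of_notMem (by simp [hi]), add_zero]

theorem degSeqR_insert {n : ℕ} {F : Finset (Sym2 (Fin n))} {e : Sym2 (Fin n)} (he : e ∉ F) :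
    degSeqR n (insert e F) = degSeqR n F + edgeVecR n e := by
  rw [← degSeqR_erase_add (Finset.mem_insert_self e F), Finset.erase_insert he]

theorem edgeVecR_ne_zero {n : ℕ} (e : Sym2 (Fin n)) : edgeVecR n e ≠ 0 := by
  intro h
  obtain ⟨i, hi⟩ : ∃ i, i ∈ e := ⟨_, e.out_fst_mem⟩
  simpa [edgeVecR, hi] using congrFun h i

/-- Moving an edge `e ∈ F₁ \ F₂` from `F₁` to `F₂` preserves the midpoint of the two degree
sequences, so an extreme segment `[d(F₁), d(F₂)]` is parallel to `d(e)`. -/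
theorem exists_smul_edgeVecR_of_mem_of_notMem {n : ℕ} {E F₁ F₂ : Finset (Sym2 (Fin n))}
    (hF₁ : F₁ ⊆ E) (hF₂ : F₂ ⊆ E)
    (hface : IsExtreme ℝ
      (convexHull ℝ {x : Fin n → ℝ | ∃ F ⊆ E, x = degSeqR n F})
      (segment ℝ (degSeqR n F₁) (degSeqR n F₂)))
    {e : Sym2 (Fin n)} (he₁ : e ∈ F₁) (he₂ : e ∉ F₂) :
    ∃ c : ℝ, c ≠ 0 ∧ degSeqR n F₂ - degSeqR n F₁ = c • edgeVecR n e := by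
  have herase := degSeqR_erase_add he₁
  have hmid : midpoint ℝ (degSeqR n F₁) (degSeqR n F₂) =
      midpoint ℝ (degSeqR n (F₁.erase e)) (degSeqR n (insert e F₂)) := by
    rw [midpoint_eq_smul_add, midpoint_eq_smul_add, degSeqR_insert he₂, ← herase]
    abel_nf
  have hmem : degSeqR n (F₁.erase e) ∈ segment ℝ (degSeqR n F₁) (degSeqR n F₂) := by
    refine hface.2 (subset_convexHull ℝ _ ⟨_, (F₁.erase_subset e).trans hF₁, rfl⟩)
      (subset_convexHull ℝ _ ⟨_, Finset.insert_subset (hF₁ he₁) hF₂, rfl⟩)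
      (midpoint_mem_segment _ _) ?_
    rw [hmid]
    exact midpoint_mem_openSegment _ _
  rw [segment_eq_image'] at hmem
  obtain ⟨t, -, ht⟩ := hmem
  have hdir : edgeVecR n e = (-t) • (degSeqR n F₂ - degSeqR n F₁) := by
    rw [neg_smul, eq_neg_iff_add_eq_zero]
    rw [← ht, add_assoc, add_eq_left] at herase
    rw [add_comm, herase]
  have ht0 : -t ≠ 0 := by
    intro h
    exact edgeVecR_ne_zero e (by rw [hdir, h, zero_smul])
  exact ⟨(-t)⁻¹, inv_ne_zero ht0, by rw [hdir, inv_smul_smul₀ ht0]⟩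

/-- every edge (one-dimensional face) `C = [d(F₁), d(F₂)]` of the
degree sequence polytope `P_H = conv{d(F) : F ⊆ E}` has a direction of the form
`d(e)` for some edge `e ∈ E`; i.e. `d(F₂) - d(F₁)` is a nonzero scalar multiple
of `d(e)`. -/
theorem edge_directions_unprescribed (n : ℕ) (E : Finset (Sym2 (Fin n)))
    (hE : ∀ e ∈ E, ¬ e.IsDiag)
    (F₁ F₂ : Finset (Sym2 (Fin n))) (hF₁ : F₁ ⊆ E) (hF₂ : F₂ ⊆ E)
    (hne : degSeqR n F₁ ≠ degSeqR n F₂)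
    (hface : IsExtreme ℝ
      (convexHull ℝ {x : Fin n → ℝ | ∃ F ⊆ E, x = degSeqR n F})
      (segment ℝ (degSeqR n F₁) (degSeqR n F₂))) :
    ∃ e ∈ E, ∃ c : ℝ, c ≠ 0 ∧
      degSeqR n F₂ - degSeqR n F₁ = c • edgeVecR n e := by
  by_cases h : F₁ ⊆ F₂
  · have h' : ¬ F₂ ⊆ F₁ := fun h' => hne (by rw [h.antisymm h'])
    obtain ⟨e, he₂, he₁⟩ := Finset.not_subset.1 h'
    obtain ⟨c, hc, heq⟩ := exists_smul_edgeVecR_of_mem_of_notMem hF₂ hF₁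
      (segment_symm ℝ (degSeqR n F₁) (degSeqR n F₂) ▸ hface) he₂ he₁
    exact ⟨e, hF₂ he₂, -c, neg_ne_zero.2 hc, by rw [neg_smul, ← heq, neg_sub]⟩
  · obtain ⟨e, he₁, he₂⟩ := Finset.not_subset.1 h
    exact ⟨e, hF₁ he₁, exists_smul_edgeVecR_of_mem_of_notMem hF₁ hF₂ hface he₁ he₂⟩
end

section
/- Let H = (I ⊎ J, E) be a bipartite graph with parts I and J in which every vertex has degree at most 3. Define f_i(z) := −(z − 1)^2 for i ∈ I and f_i(z) := z(z − 3) for i ∈ J. Then for every subgraph G = (I ⊎ J, F) with F ⊆ E, Σ_i f_i(d_i(G)) ≤ 0, with equality if and only if d_i(G) = 1 for all i ∈ I and d_i(G) ∈ {0, 3} for all i ∈ J. Consequently, the maximum of Σ_i f_i(d_i(G)) over all subgraphs G of H equals 0 if and only if H has a subgraph in which every vertex of I has degree 1 and every vertex of J has degree 0 or 3. -/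
/-- The degree of vertex `v` in the subgraph with edge set `F` (as an integer). -/
def degB {V : Type*} [DecidableEq V] (F : Finset (Sym2 V)) (v : V) : ℤ :=
  ((F.filter (fun e => v ∈ e)).card : ℤ)

theorem degB_nonneg {V : Type*} [DecidableEq V] (F : Finset (Sym2 V)) (v : V) :
    0 ≤ degB F v :=
  Int.natCast_nonneg _

theorem degB_mono {V : Type*} [DecidableEq V] {F E : Finset (Sym2 V)} (h : F ⊆ E) (v : V) :
    degB F v ≤ degB E v :=
  Int.ofNat_le.mpr (Finset.card_le_card (Finset.filter_subset_filter _ h))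

/-- let `H = (I ⊎ J, E)` be bipartite with maximum degree at most
`3`, and let `f_i(z) = -(z-1)²` for `i ∈ I` and `f_j(z) = z(z-3)` for `j ∈ J`.
Then `∑_v f_v(d_v(F)) ≤ 0` for every `F ⊆ E`, with equality iff every vertex of
`I` has degree `1` and every vertex of `J` has degree `0` or `3`; consequently
the maximum over all subgraphs equals `0` iff such a subgraph exists. -/
theorem bipartite_concave_convex_reduction (I J : Type*)
    [Fintype I] [Fintype J] [DecidableEq I] [DecidableEq J]
    (E : Finset (Sym2 (I ⊕ J)))
    (hbip : ∀ e ∈ E, ∃ (i : I) (j : J), e = s(Sum.inl i, Sum.inr j))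
    (hdeg : ∀ v : I ⊕ J, degB E v ≤ 3)
    (f : I ⊕ J → ℤ → ℤ)
    (hfI : ∀ (i : I) (z : ℤ), f (Sum.inl i) z = -(z - 1) ^ 2)
    (hfJ : ∀ (j : J) (z : ℤ), f (Sum.inr j) z = z * (z - 3)) :
    (∀ F ⊆ E, ∑ v : I ⊕ J, f v (degB F v) ≤ 0) ∧
    (∀ F ⊆ E,
      (∑ v : I ⊕ J, f v (degB F v) = 0 ↔
        (∀ i : I, degB F (Sum.inl i) = 1) ∧
        (∀ j : J, degB F (Sum.inr j) = 0 ∨ degB F (Sum.inr j) = 3))) ∧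
    ((∃ F ⊆ E, ∑ v : I ⊕ J, f v (degB F v) = 0) ↔
      ∃ F ⊆ E, (∀ i : I, degB F (Sum.inl i) = 1) ∧
        (∀ j : J, degB F (Sum.inr j) = 0 ∨ degB F (Sum.inr j) = 3)) := by
  have hterm : ∀ F ⊆ E, ∀ v ∈ Finset.univ, f v (degB F v) ≤ 0 := by
    rintro F hF (i | j) -
    · rw [hfI]
      nlinarith [sq_nonneg (degB F (Sum.inl i) - 1)]
    · rw [hfJ]
      exact mul_nonpos_of_nonneg_of_nonpos (degB_nonneg F _)
        (by linarith [degB_mono hF (Sum.inr j), hdeg (Sum.inr j)])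
  have heq : ∀ F ⊆ E, (∑ v : I ⊕ J, f v (degB F v) = 0 ↔
      (∀ i : I, degB F (Sum.inl i) = 1) ∧
      (∀ j : J, degB F (Sum.inr j) = 0 ∨ degB F (Sum.inr j) = 3)) := by
    intro F hF
    rw [Finset.sum_eq_zero_iff_of_nonpos (hterm F hF)]
    simp [hfI, hfJ, sub_eq_zero]
  exact ⟨fun F hF => Finset.sum_nonpos (hterm F hF), heq,
    exists_congr fun F => and_congr_right (heq F)⟩
end
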